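/- Let H be a finite group of exponent n_H and L a field of characteristic zero containing a primitive n_H-th root of unity. If a twisted group algebra L^α H over L (encoded as in the context) is a division ring, then H is abelian. -/

import Mathlib

universe u

set_option linter.unusedSimpArgs false

theorem tw_root {D : Type*} [DivisionRing D] (n : ℕ) (hn : 0 < n) (ζ : D)
    (hz : ζ ∈ Subring.center D) (hζ : orderOf ζ = n) (x : D) (hx : x ^ n = 1) :
    ∃ i, x = ζ ^ i := by
  let z : Subring.center D := ⟨ζ, hz⟩
  have hzo : orderOf z = n := by
    rw [← hζ]
    exact (orderOf_injective (Subring.center D).subtype.toMonoidHom Subtype.val_injective z).symm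
  have hzp : IsPrimitiveRoot z n := hzo ▸ IsPrimitiveRoot.orderOf z
  have hint : IsIntegral (Subring.center D) x := by
    refine ⟨Polynomial.X ^ n - 1, Polynomial.monic_X_pow_sub_C 1 hn.ne', ?_⟩
    simp [hx]
  have hp : Prime (minpoly (Subring.center D) x) := (minpoly.irreducible hint).prime
  have hd : minpoly (Subring.center D) x ∣ Polynomial.X ^ n - 1 := by
    apply minpoly.dvd; simp [hx]
  rw [Polynomial.X_pow_sub_one_eq_prod hn hzp] at hd
  obtain ⟨w, hw, hdw⟩ := hp.exists_mem_finset_dvd hd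
  have := Polynomial.aeval_eq_zero_of_dvd_aeval_eq_zero hdw (minpoly.aeval _ x)
  simp at this
  rw [Polynomial.mem_nthRootsFinset hn] at hw
  have hne : NeZero n := ⟨hn.ne'⟩
  obtain ⟨i, -, hi⟩ := hzp.eq_pow_of_pow_eq_one hw
  refine ⟨i, ?_⟩
  rw [sub_eq_zero] at this
  rw [this, ← hi]; rfl

theorem tw_pow' {G : Type*} [Group G] (c y l : G) (hl : ∀ g, Commute l g)
    (h : c * y = l * (y * c)) (k : ℕ) : c * y ^ k = l ^ k * (y ^ k * c) := by
  induction k with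
  | zero => simp
  | succ k ih =>
    rw [pow_succ, ← mul_assoc, ih, mul_assoc, mul_assoc, h, pow_succ]
    rw [← mul_assoc (y ^ k) l, ← (hl (y^k)).eq]; simp only [mul_assoc]

theorem tw_pow {G : Type*} [Group G] (c y l : G) (hl : ∀ g, Commute l g)
    (h : c * y = l * (y * c)) (k : ℕ) : l ^ (k.choose 2) * (c * y) ^ k = c ^ k * y ^ k := by
  have h3 : ∀ k : ℕ, l ^ k * (y ^ k * c) = c * y ^ k := fun k => (tw_pow' c y l hl h k).symm
  induction k with
  | zero => simp
  | succ k ih =>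
    have e : (k+1).choose 2 = k + k.choose 2 := by rw [Nat.choose_succ_succ' k 1]; simp
    rw [e, pow_add, pow_succ (c*y), mul_assoc, ← mul_assoc _ ((c*y)^k), ih, ← mul_assoc,
      ← mul_assoc, ← mul_assoc, ((hl (c^k)).pow_left k).eq, mul_assoc (c^k), mul_assoc (c^k),
      mul_assoc (l^k), h3, pow_succ, pow_succ]
    simp only [mul_assoc]

theorem tw_sq {D : Type*} [DivisionRing D] (l : Dˣ) (h : l ^ 2 = 1) : l = 1 ∨ l = -1 := by
  have : (l : D) * l = 1 := by rw [← sq, ← Units.val_pow_eq_pow_val, h, Units.val_one]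
  rcases mul_self_eq_one_iff.mp this with h | h
  · left; ext; simpa using h
  · right; ext; simpa using h

theorem tw_key {D : Type*} [DivisionRing D] (L : Subgroup Dˣ)
    (hL : ∀ l ∈ L, ∀ d : Dˣ, Commute l d) (n : ℕ) (hR : ∀ x : Dˣ, x ^ n = 1 → x ∈ L)
    (x y c l : Dˣ) (hc : c = x * y * x⁻¹ * y⁻¹) (hl : l ∈ L) (h : c * y = l * (y * c))
    (k : ℕ) (hk : k ∣ n) (hy : y ^ k ∈ L) :
    c ∈ L ∨ (l = -1 ∧ c ^ 2 ∈ L ∧ c ^ k = -1 ∧ (∃ r, k = 2 * r ∧ Odd r) ∧ ¬ 4 ∣ n) := by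
  have hR' : ∀ m, m ∣ n → ∀ x : Dˣ, x ^ m = 1 → x ∈ L := by
    rintro m ⟨d, rfl⟩ x hx
    apply hR; rw [pow_mul, hx, one_pow]
  have h1 := tw_pow c y l (hL l hl) h k
  have h2 : c * y = x * y * x⁻¹ := by rw [hc]; group
  have h3 : (c * y) ^ k = y ^ k := by
    rw [h2, conj_pow, ← (hL _ hy x).eq]; group
  rw [h3] at h1
  have h4 : c ^ k = l ^ k.choose 2 := (mul_right_cancel h1).symm
  have h5 : l ^ k = 1 := by
    have := tw_pow' c y l (hL l hl) h k
    rw [← (hL _ hy c).eq] at this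
    exact (mul_eq_right.mp this.symm)
  rcases Nat.even_or_odd' k with ⟨r, hr | hr⟩
  · have e : k.choose 2 = r * (k - 1) := by
      rw [Nat.choose_two_right, hr, mul_assoc, Nat.mul_div_cancel_left _ (by norm_num)]
    have h6 : (c ^ 2) ^ k = 1 := by
      rw [← pow_mul, mul_comm, pow_mul, h4, ← pow_mul, e,
        show r * (k - 1) * 2 = k * (k - 1) by rw [hr]; ring, pow_mul, h5, one_pow]
    have h7 := hR' k hk _ h6
    have h8 : l ^ 2 = 1 := by
      have h9 : c * (c * y) = l ^ 2 * (y * (c * c)) := by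
        rw [h, ← mul_assoc, ← (hL l hl c).eq, mul_assoc, ← mul_assoc c y, h, sq]
        simp only [mul_assoc]
      rw [← mul_assoc, ← sq, (hL _ h7 y).eq] at h9
      exact (mul_eq_right.mp h9.symm)
    rcases tw_sq l h8 with h9 | h9
    · left; apply hR' k hk; rw [h4, h9, one_pow]
    · rcases Nat.even_or_odd r with h10 | h10
      · left; apply hR' k hk; rw [h4, h9, e, pow_mul, h10.neg_one_pow, one_pow]
      · by_cases h4n : 4 ∣ n
        · left
          have : 2 * k ∣ n := by
            rw [hr, ← mul_assoc]
            apply Nat.Coprime.mul_dvd_of_dvd_of_dvd _ h4n ((Dvd.intro_left 2 hr.symm).trans hk)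
            exact (Nat.Coprime.pow_left 2 (Nat.coprime_two_left.mpr h10))
          apply hR' _ this
          rw [pow_mul, h6]
        · right
          refine ⟨h9, h7, ?_, ⟨r, hr, h10⟩, h4n⟩
          have : Odd (k - 1) := by
            obtain ⟨s, hs⟩ := h10
            exact ⟨2 * s, by omega⟩
          rw [h4, h9, e, (h10.mul this).neg_one_pow]
  · left
    apply hR' k hk
    have e : k.choose 2 = k * r := by
      rw [Nat.choose_two_right, hr]; simp
      rw [mul_comm 2 r, ← mul_assoc, Nat.mul_div_cancel _ (by norm_num)]
    rw [h4, e, pow_mul, h5, one_pow]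

/-- the quaternion contradiction -/
theorem tw_quat {D : Type*} [DivisionRing D] (h2 : (2 : D) ≠ 0) (i j w : D)
    (hi : i * i = -1) (hj : j * j = -1) (hij : i * j = - (j * i))
    (hw : ∀ d : D, w * d = d * w) (hw3 : w * w + w + 1 = 0) : False := by
  have hw0 : w ≠ 0 := by rintro rfl; simp at hw3
  have hw3' : w * w * w = 1 := by
    have : w * w * w - 1 = (w * w + w + 1) * (w - 1) := by noncomm_ring
    rw [hw3, zero_mul] at this; exact sub_eq_zero.mp this
  have e : (w * i + w * w * j) * (w * i + w * w * j) = 1 := by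
    have e1 : (w * i + w * w * j) * (w * i + w * w * j)
      = w * w * (i * i) + w * w * w * (i * j + j * i) + w * w * w * w * (j * j) := by
      have a1 : w * i * (w * i) = w * w * (i * i) := by
        rw [mul_assoc, ← mul_assoc i w i, ← hw i]; simp only [mul_assoc]
      have a2 : w * i * (w * w * j) = w * w * w * (i * j) := by
        rw [mul_assoc, ← mul_assoc i _ j, ← mul_assoc i w w, ← hw i, mul_assoc w i w, ← hw i]
        simp only [mul_assoc]
      have a3 : w * w * j * (w * i) = w * w * w * (j * i) := by
        rw [mul_assoc, ← mul_assoc j w i, ← hw j]; simp only [mul_assoc]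
      have a4 : w * w * j * (w * w * j) = w * w * w * w * (j * j) := by
        rw [mul_assoc, ← mul_assoc j _ j, ← mul_assoc j w w, ← hw j, mul_assoc w j w, ← hw j]
        simp only [mul_assoc]
      rw [add_mul, mul_add, mul_add, a1, a2, a3, a4, mul_add]; abel
    rw [e1, hi, hj, hij, hw3']
    have : w * w = -w - 1 := by
      rw [eq_sub_iff_add_eq, eq_neg_iff_add_eq_zero, ← hw3]; abel
    rw [this]; simp
  have hcomm : Commute i (w * i + w * w * j) := by
    rcases mul_self_eq_one_iff.mp e with h | h <;> rw [h]
    · exact Commute.one_right i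
    · exact (Commute.one_right i).neg_right
  have hc2 : Commute i (w * w * j) := by
    have : w * w * j = (w * i + w * w * j) - w * i := by abel
    rw [this]
    exact hcomm.sub_right ((show Commute i w from (hw i).symm).mul_right (Commute.refl i))
  have hw' : Commute i w := (hw i).symm
  have h4 : w * w * (i * j) = w * w * (j * i) := by
    have := hc2.eq
    rw [← mul_assoc, (hw'.mul_right hw').eq] at this
    simpa only [mul_assoc] using this
  have h5 := mul_left_cancel₀ (mul_ne_zero hw0 hw0) h4
  rw [hij] at h5
  have h6 : (2 : D) * (j * i) = 0 := by rw [two_mul]; nth_rewrite 1 [← h5]; simp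
  have hi0 : i ≠ 0 := by rintro rfl; simp at hi
  have hj0 : j ≠ 0 := by rintro rfl; simp at hj
  exact mul_ne_zero h2 (mul_ne_zero hj0 hi0) h6

theorem tw_commsq {D : Type*} [DivisionRing D] (s t : Dˣ) (hs : s ^ 2 = -1) (ht : t ^ 2 = -1)
    (h : Commute s t) : s * t⁻¹ = 1 ∨ s * t⁻¹ = -1 := by
  apply tw_sq
  rw [h.inv_right.mul_pow, inv_pow, hs, ht]; simp

theorem tw_anti {D : Type*} [DivisionRing D] (s t l : Dˣ) (hs : s ^ 2 = -1)
    (hl : ∀ d : Dˣ, Commute l d) (h : s * t = l * (t * s)) : Commute s t ∨ s * t = - (t * s) := by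
  have h8 : l ^ 2 = 1 := by
    have h9 : s * (s * t) = l ^ 2 * (t * (s * s)) := by
      rw [h, ← mul_assoc, ← (hl s).eq, mul_assoc, ← mul_assoc s t, h, sq]
      simp only [mul_assoc]
    rw [← mul_assoc, ← sq, hs] at h9
    simpa using h9.symm
  rcases tw_sq l h8 with h9 | h9
  · left; rw [h9, one_mul] at h; exact h
  · right; rw [h9] at h; simpa using h

theorem tw_q1 {D : Type*} [DivisionRing D] (i j k : Dˣ) (hik : i * k = -(k * i))
    (hjk : j * k = -(k * j)) : Commute k (i * j) := by
  show k * (i * j) = i * j * k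
  rw [mul_assoc i j k, hjk, mul_neg, ← mul_assoc, ← mul_assoc, hik]; simp

theorem tw_q2 {D : Type*} [DivisionRing D] (i j : Dˣ) (hi2 : i ^ 2 = -1) (hj2 : j ^ 2 = -1)
    (hij : i * j = -(j * i)) : (i * j) ^ 2 = -1 := by
  have e : (i * j) ^ 2 = -(i ^ 2 * j ^ 2) := by
    have h : j * i = -(i * j) := by rw [hij, neg_neg]
    calc (i * j) ^ 2 = i * (j * i) * j := by rw [sq]; simp only [mul_assoc]
      _ = -(i ^ 2 * j ^ 2) := by rw [h, sq, sq]; simp [mul_assoc]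
  rw [e, hi2, hj2]; simp

theorem tw_compl {D : Type*} [DivisionRing D] (hD2 : (2 : D) ≠ 0) (L : Subgroup Dˣ) [L.Normal]
    (hL : ∀ l ∈ L, ∀ d : Dˣ, Commute l d) (n : ℕ) (hn : 0 < n)
    (hR : ∀ x : Dˣ, x ^ n = 1 → x ∈ L)
    (ζ : Dˣ) (hζL : ζ ∈ L) (hζ : orderOf ζ = n)
    {H : Type*} [Group H] [Finite H] (f : H →* Dˣ ⧸ L) (hf : Function.Injective f)
    (hex : ∀ h : H, orderOf h ∣ n)
    (K : Subgroup H) [K.Normal] (hK : ∀ g ∈ K, ∀ h ∈ K, g * h = h * g)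
    (a b : H) (hb : b ∈ K) (hcop : (Nat.card K).Coprime (orderOf a)) : a * b = b * a := by
  obtain ⟨x, hx⟩ := QuotientGroup.mk_surjective (f a)
  obtain ⟨y, hy⟩ := QuotientGroup.mk_surjective (f b)
  -- commuting in `H` gives commuting up to `L`
  have hcomm : ∀ (g h : H) (s t : Dˣ), (s : Dˣ ⧸ L) = f g → (t : Dˣ ⧸ L) = f h → g * h = h * g →
      ∃ l ∈ L, s * t = l * (t * s) := by
    intro g h s t hs ht hgh
    refine ⟨s * t * (t * s)⁻¹, ?_, by group⟩
    rw [← QuotientGroup.eq_one_iff]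
    simp only [QuotientGroup.mk_mul, QuotientGroup.mk_inv, QuotientGroup.mk_pow]
    rw [hs, ht, ← map_mul, ← map_mul, hgh, mul_inv_cancel]
  set γ := a * b * a⁻¹ * b⁻¹ with hγ
  set c := x * y * x⁻¹ * y⁻¹ with hc
  have hγK : γ ∈ K := K.mul_mem (Subgroup.Normal.conj_mem inferInstance b hb a) (K.inv_mem hb)
  have hfc : (c : Dˣ ⧸ L) = f γ := by
    rw [hc, hγ]; simp only [QuotientGroup.mk_mul, QuotientGroup.mk_inv, QuotientGroup.mk_pow]; rw [hx, hy]; simp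
  by_contra hab
  have hγ1 : γ ≠ 1 := by
    intro h
    apply hab
    have : a * b * a⁻¹ * b⁻¹ * (b * a) = a * b := by group
    rw [← this, ← hγ, h, one_mul]
  obtain ⟨l, hl, hcy⟩ := hcomm γ b c y hfc hy (hK _ hγK _ hb)
  have hyk : y ^ orderOf b ∈ L := by
    rw [← QuotientGroup.eq_one_iff]; simp only [QuotientGroup.mk_mul, QuotientGroup.mk_inv, QuotientGroup.mk_pow]; rw [hy, ← map_pow, pow_orderOf_eq_one, map_one]
  rcases tw_key L hL n hR x y c l hc hl hcy (orderOf b) (hex b) hyk with h | ⟨-, hc2, hck, ⟨r, hkr, hr⟩, -⟩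
  · apply hγ1; apply hf; rw [map_one, ← hfc, QuotientGroup.eq_one_iff]; exact h
  have hγ2 : γ ^ 2 = 1 := by
    apply hf; rw [map_pow, map_one, ← hfc, ← QuotientGroup.mk_pow, QuotientGroup.eq_one_iff]; exact hc2
  have hoγ : orderOf γ = 2 := orderOf_eq_prime hγ2 hγ1
  have hq : (2).Coprime (orderOf a) := by
    apply Nat.Coprime.coprime_dvd_left _ hcop
    rw [← hoγ]; exact Subgroup.orderOf_dvd_natCard K hγK
  have hN1 : ¬ Commute a γ := by
    intro h
    have hj : ∀ j : ℕ, a ^ j * b = γ ^ j * (b * a ^ j) := by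
      intro j
      induction j with
      | zero => simp
      | succ j ih =>
        have e : a * b = γ * (b * a) := by rw [hγ]; group
        rw [pow_succ', mul_assoc, ih, ← mul_assoc, (h.pow_right j).eq, mul_assoc, ← mul_assoc a b,
          e, pow_succ γ]
        simp only [mul_assoc]
    have := hj (orderOf a)
    rw [pow_orderOf_eq_one, mul_one, one_mul] at this
    have h3 : γ ^ orderOf a = 1 := mul_eq_right.mp this.symm
    have h4 := orderOf_dvd_of_pow_eq_one h3
    rw [hoγ] at h4
    have := Nat.Coprime.eq_one_of_dvd hq h4
    omega
  have hN : ∀ m : ℕ, m.Coprime (orderOf a) → ¬ Commute (a ^ m) γ := by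
    intro m hm h
    obtain ⟨s, hs⟩ := exists_pow_eq_self_of_coprime hm
    apply hN1
    rw [← hs]; exact h.pow_left s
  -- the quaternion units
  have hneg : (-1 : Dˣ) ∈ L := by
    apply hR
    obtain ⟨d, hd⟩ := hex b
    rw [hd, hkr, mul_assoc, pow_mul]; simp
  set i := c ^ r with hi
  have hi2 : i ^ 2 = -1 := by rw [hi, ← pow_mul, mul_comm, ← hkr, hck]
  have hfi : (i : Dˣ ⧸ L) = f γ := by
    rw [hi, QuotientGroup.mk_pow, hfc, ← map_pow]
    obtain ⟨s, rfl⟩ := hr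
    rw [pow_succ, pow_mul, hγ2, one_pow, one_mul]
  set j := x * i * x⁻¹ with hj
  set k := x * j * x⁻¹ with hk
  set γ1 := a * γ * a⁻¹ with hγ1d
  set γ2 := a * γ1 * a⁻¹ with hγ2d
  have hj2 : j ^ 2 = -1 := by rw [hj, conj_pow, hi2]; simp
  have hk2 : k ^ 2 = -1 := by rw [hk, conj_pow, hj2]; simp
  have hfj : (j : Dˣ ⧸ L) = f γ1 := by rw [hj, hγ1d]; simp only [QuotientGroup.mk_mul, QuotientGroup.mk_inv, QuotientGroup.mk_pow]; rw [hx, hfi]; simp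
  have hfk : (k : Dˣ ⧸ L) = f γ2 := by rw [hk, hγ2d]; simp only [QuotientGroup.mk_mul, QuotientGroup.mk_inv, QuotientGroup.mk_pow]; rw [hx, hfj]; simp
  have hγ1K : γ1 ∈ K := Subgroup.Normal.conj_mem inferInstance _ hγK a
  have hγ2K : γ2 ∈ K := Subgroup.Normal.conj_mem inferInstance _ hγ1K a
  have hpm : ∀ (s t : Dˣ) (g h : H), s ^ 2 = -1 → t ^ 2 = -1 → Commute s t →
      (s : Dˣ ⧸ L) = f g → (t : Dˣ ⧸ L) = f h → g = h := by
    intro s t g h hs ht hst hsg hth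
    have : s * t⁻¹ ∈ L := by
      rcases tw_commsq s t hs ht hst with e | e <;> rw [e]
      · exact L.one_mem
      · exact hneg
    rw [← QuotientGroup.eq_one_iff] at this
    simp only [QuotientGroup.mk_mul, QuotientGroup.mk_inv] at this
    rw [hsg, hth, mul_inv_eq_one] at this
    exact hf this
  have hant : ∀ (s t : Dˣ) (g h : H), s ^ 2 = -1 → t ^ 2 = -1 → g ∈ K → h ∈ K →
      (s : Dˣ ⧸ L) = f g → (t : Dˣ ⧸ L) = f h → g ≠ h → s * t = -(t * s) := by
    intro s t g h hs ht hgK hhK hsg hth hne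
    obtain ⟨l, hl, e⟩ := hcomm g h s t hsg hth (hK _ hgK _ hhK)
    rcases tw_anti s t l hs (hL l hl) e with e | e
    · exact absurd (hpm s t g h hs ht e hsg hth) hne
    · exact e
  have hij : i * j = -(j * i) := by
    refine hant i j γ γ1 hi2 hj2 hγK hγ1K hfi hfj ?_
    intro e
    apply hN1
    show a * γ = γ * a
    nth_rewrite 2 [e]; rw [hγ1d]; group
  have hik : i * k = -(k * i) := by
    refine hant i k γ γ2 hi2 hk2 hγK hγ2K hfi hfk ?_
    intro e
    apply hN 2 hq
    show a ^ 2 * γ = γ * a ^ 2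
    nth_rewrite 2 [e]; rw [hγ2d, hγ1d, sq]; group
  have hjk : j * k = -(k * j) := by
    have e1 : j * k = x * (i * j) * x⁻¹ := by rw [hk]; nth_rewrite 1 [hj]; group
    have e2 : k * j = x * (j * i) * x⁻¹ := by rw [hk]; nth_rewrite 2 [hj]; group
    rw [e1, e2, hij]; simp
  have hkij : Commute k (i * j) := tw_q1 i j k hik hjk
  have hij2 : (i * j) ^ 2 = -1 := tw_q2 i j hi2 hj2 hij
  have hγ2e : γ2 = γ * γ1 := by
    refine hpm k (i * j) _ _ hk2 hij2 hkij hfk ?_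
    rw [QuotientGroup.mk_mul, hfi, hfj, map_mul f γ γ1]
  have h3 : a ^ 3 * γ = γ * a ^ 3 := by
    have e1 : a * γ2 * a⁻¹ = γ1 * γ2 := by
      nth_rewrite 1 [hγ2e]; rw [hγ2d]; nth_rewrite 2 [hγ1d]; group
    have e2 : γ1 * γ2 = γ := by
      have : γ1 ^ 2 = 1 := by rw [hγ1d, conj_pow, hγ2]; simp
      rw [hγ2e, hK γ hγK γ1 hγ1K, ← mul_assoc, ← sq, this, one_mul]
    rw [e2] at e1
    nth_rewrite 2 [← e1]
    rw [hγ2d, hγ1d]; simp only [pow_succ, pow_zero]; group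
  have h3q : 3 ∣ n := by
    by_contra hnd
    have : ¬ 3 ∣ orderOf a := fun h => hnd (h.trans (hex a))
    exact hN 3 ((Nat.Prime.coprime_iff_not_dvd Nat.prime_three).mpr this) h3
  obtain ⟨d, hd⟩ := h3q
  set w := ζ ^ d with hw
  have hd0 : 0 < d := by omega
  have hw1 : w ≠ 1 := by
    intro h
    have := orderOf_dvd_of_pow_eq_one h
    rw [hζ] at this
    have := Nat.le_of_dvd hd0 this
    omega
  have hw3 : w ^ 3 = 1 := by rw [hw, ← pow_mul, mul_comm, ← hd, ← hζ, pow_orderOf_eq_one]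
  have hwL : w ∈ L := L.pow_mem hζL d
  have hsq : ∀ u : Dˣ, u ^ 2 = -1 → (u : D) * u = -1 := by
    intro u hu
    rw [← sq, ← Units.val_pow_eq_pow_val, hu]; simp
  refine tw_quat hD2 (i : D) j w (hsq i hi2) (hsq j hj2) ?_ ?_ ?_
  · rw [← Units.val_mul, hij]; simp
  · intro z
    by_cases hz : z = 0
    · simp [hz]
    · have := congrArg Units.val (hL w hwL (Units.mk0 z hz)).eq
      simpa using this
  · have e : ((w : D) * w + w + 1) * (w - 1) = 0 := by
      have : (w : D) ^ 3 = 1 := by rw [← Units.val_pow_eq_pow_val, hw3]; simp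
      rw [← sub_eq_zero] at this
      rw [← this]; noncomm_ring
    rcases mul_eq_zero.mp e with h | h
    · exact h
    · exfalso; apply hw1; ext; simpa using sub_eq_zero.mp h

theorem tw_pgroup {D : Type*} [DivisionRing D] (L : Subgroup Dˣ) [L.Normal]
    (hL : ∀ l ∈ L, ∀ d : Dˣ, Commute l d) (n : ℕ)
    (hR : ∀ x : Dˣ, x ^ n = 1 → x ∈ L)
    {H : Type*} [Group H] [Finite H] (f : H →* Dˣ ⧸ L) (hf : Function.Injective f)
    (hex : ∀ h : H, orderOf h ∣ n) (p : ℕ) [Fact p.Prime] (hp : IsPGroup p H) :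
    ∀ a b : H, a * b = b * a := by
  by_contra hne
  have hnt : Nontrivial (H ⧸ Subgroup.center H) := by
    rw [← not_subsingleton_iff_nontrivial]
    intro hs
    have := QuotientGroup.subgroup_eq_top_of_subsingleton _ hs
    apply hne
    intro a b
    have ha : b ∈ Subgroup.center H := by rw [this]; trivial
    exact Subgroup.mem_center_iff.mp ha a
  obtain ⟨⟨q, hq⟩, hq1⟩ := (nontrivial_iff_exists_ne (1 : Subgroup.center (H ⧸ Subgroup.center H))).mp
    (hp.to_quotient (Subgroup.center H)).center_nontrivial
  obtain ⟨a, rfl⟩ := QuotientGroup.mk_surjective q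
  have ha : a ∉ Subgroup.center H := by
    intro h
    apply hq1
    ext
    exact (QuotientGroup.eq_one_iff a).mpr h
  rw [Subgroup.mem_center_iff] at ha
  push Not at ha
  obtain ⟨b, hab⟩ := ha
  obtain ⟨x, hx⟩ := QuotientGroup.mk_surjective (f a)
  obtain ⟨y, hy⟩ := QuotientGroup.mk_surjective (f b)
  set γ := a * b * a⁻¹ * b⁻¹ with hγ
  set c := x * y * x⁻¹ * y⁻¹ with hc
  have hfc : (c : Dˣ ⧸ L) = f γ := by
    rw [hc, hγ]; simp only [QuotientGroup.mk_mul, QuotientGroup.mk_inv, QuotientGroup.mk_pow]; rw [hx, hy]; simp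
  have hγZ : γ ∈ Subgroup.center H := by
    rw [← QuotientGroup.eq_one_iff, hγ]
    have := Subgroup.mem_center_iff.mp hq (b : H ⧸ Subgroup.center H)
    simp only [QuotientGroup.mk_mul, QuotientGroup.mk_inv, QuotientGroup.mk_pow]
    rw [← this]; group
  have hγ1 : γ ≠ 1 := by
    intro h
    apply hab
    have : a * b * a⁻¹ * b⁻¹ * (b * a) = a * b := by group
    rw [← this, ← hγ, h, one_mul]
  obtain ⟨l, hl, hcy⟩ : ∃ l ∈ L, c * y = l * (y * c) := by
    refine ⟨c * y * (y * c)⁻¹, ?_, by group⟩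
    rw [← QuotientGroup.eq_one_iff]
    simp only [QuotientGroup.mk_mul, QuotientGroup.mk_inv, QuotientGroup.mk_pow]
    rw [hfc, hy, ← map_mul, ← map_mul, Subgroup.mem_center_iff.mp hγZ b, mul_inv_cancel]
  have hyk : y ^ orderOf b ∈ L := by
    rw [← QuotientGroup.eq_one_iff]; simp only [QuotientGroup.mk_mul, QuotientGroup.mk_inv, QuotientGroup.mk_pow]; rw [hy, ← map_pow, pow_orderOf_eq_one, map_one]
  rcases tw_key L hL n hR x y c l hc hl hcy (orderOf b) (hex b) hyk with h | ⟨-, hc2, hck, ⟨r, hkr, hr⟩, h4⟩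
  · apply hγ1; apply hf; rw [map_one, ← hfc, QuotientGroup.eq_one_iff]; exact h
  have hp2 : p = 2 := by
    obtain ⟨m, hm⟩ := IsPGroup.iff_orderOf.mp hp b
    have h2 : 2 ∣ p ^ m := by rw [← hm, hkr]; exact dvd_mul_right _ _
    exact ((Nat.prime_dvd_prime_iff_eq Nat.prime_two Fact.out).mp
      (Nat.prime_two.dvd_of_dvd_pow h2)).symm
  subst hp2
  have hsq : ∀ g : H, g ^ 2 = 1 := by
    intro g
    obtain ⟨m, hm⟩ := IsPGroup.iff_orderOf.mp hp g
    have hd := hex g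
    rw [← orderOf_dvd_iff_pow_eq_one, hm]
    rcases Nat.lt_or_ge m 2 with h | h
    · exact pow_dvd_pow 2 (show m ≤ 1 by omega)
    · exact absurd ((pow_dvd_pow 2 h).trans (hm ▸ hd)) h4
  apply hab
  have e := hsq (a * b)
  have ea := hsq a
  have eb := hsq b
  rw [sq, mul_eq_one_iff_eq_inv] at e ea eb
  rw [e, mul_inv_rev, ← ea, ← eb]

theorem tw_main {D : Type*} [DivisionRing D] (hD2 : (2 : D) ≠ 0) (L : Subgroup Dˣ) [L.Normal]
    (hL : ∀ l ∈ L, ∀ d : Dˣ, Commute l d) (n : ℕ) (hn : 0 < n)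
    (hR : ∀ x : Dˣ, x ^ n = 1 → x ∈ L)
    (ζ : Dˣ) (hζL : ζ ∈ L) (hζ : orderOf ζ = n) (N : ℕ) :
    ∀ {H : Type u} [Group H] [Finite H] (f : H →* Dˣ ⧸ L) (_ : Function.Injective f)
    (_ : ∀ h : H, orderOf h ∣ n) (_ : Nat.card H = N), ∀ a b : H, a * b = b * a := by
  induction N using Nat.strong_induction_on with
  | _ N ih =>
  intro H _ _ f hf hex hN
  by_cases hpg : ∃ p : ℕ, p.Prime ∧ IsPGroup p H
  · obtain ⟨p, hp, hpg⟩ := hpg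
    have : Fact p.Prime := ⟨hp⟩
    exact tw_pgroup L hL n hR f hf hex p hpg
  have hsub : ∀ K : Subgroup H, K ≠ ⊤ → ∀ a ∈ K, ∀ b ∈ K, a * b = b * a := by
    intro K hK a ha b hb
    have hlt : Nat.card K < N := by
      rw [← hN]
      exact lt_of_le_of_ne (Subgroup.card_le_card_group K) (fun h => hK (Subgroup.eq_top_of_card_eq K h))
    have := ih _ hlt (H := K) (f.comp K.subtype) (hf.comp Subtype.val_injective)
      (fun h => by rw [← Subgroup.orderOf_coe]; exact hex _) rfl ⟨a, ha⟩ ⟨b, hb⟩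
    exact congrArg Subtype.val this
  have hSyl : ∀ (p : ℕ) (_ : p.Prime) (P : Sylow p H), (P : Subgroup H) ≠ ⊤ := by
    intro p hp P h
    apply hpg
    refine ⟨p, hp, ?_⟩
    have := P.isPGroup'
    rw [h] at this
    exact this.of_equiv Subgroup.topEquiv
  by_cases hnorm : ∀ (p : ℕ) (_ : Fact p.Prime) (P : Sylow p H), (P : Subgroup H).Normal
  · obtain ⟨e⟩ := ((Group.isNilpotent_of_finite_tfae (G := H)).out 3 4).mp hnorm
    intro a b
    apply e.symm.injective
    rw [map_mul, map_mul]
    ext p P : 2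
    have hp := Nat.prime_of_mem_primeFactors p.2
    exact Subtype.ext (hsub P (hSyl p hp P) _ (e.symm a p P).2 _ (e.symm b p P).2)
  · push Not at hnorm
    obtain ⟨p, hp, P, hP⟩ := hnorm
    have hNP : Subgroup.normalizer (P : Set H) ≠ ⊤ := fun h => hP (Subgroup.normalizer_eq_top_iff.mp h)
    have hNC : Subgroup.normalizer (P : Set H) ≤ Subgroup.centralizer (P : Set H) := by
      intro g hg
      rw [Subgroup.mem_centralizer_iff]
      intro h hh
      exact hsub _ hNP _ (Subgroup.le_normalizer hh) _ hg
    have hcompl := MonoidHom.ker_transferSylow_isComplement' P hNC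
    have hcard := MonoidHom.not_dvd_card_ker_transferSylow P hNC
    set K := (MonoidHom.transferSylow P hNC).ker with hKdef
    have hKtop : K ≠ ⊤ := by
      intro h
      rw [h] at hcompl
      apply hP
      have := Subgroup.isComplement'_top_left.mp hcompl
      rw [this]; infer_instance
    have hKc := hsub K hKtop
    have hPc := hsub P (hSyl p hp.out P)
    have hKP : ∀ a ∈ (P : Subgroup H), ∀ b ∈ K, a * b = b * a := by
      intro a ha b hb
      refine tw_compl hD2 L hL n hn hR ζ hζL hζ f hf hex K hKc a b hb ?_
      obtain ⟨m, hm⟩ := IsPGroup.iff_orderOf.mp P.isPGroup' ⟨a, ha⟩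
      rw [← Subgroup.orderOf_coe] at hm
      change orderOf a = _ at hm
      rw [hm]
      exact (Nat.Coprime.pow_left m ((Nat.Prime.coprime_iff_not_dvd hp.out).mpr hcard)).symm
    intro a b
    obtain ⟨⟨⟨k1, hk1⟩, ⟨p1, hp1⟩⟩, h1⟩ := hcompl.2 a
    obtain ⟨⟨⟨k2, hk2⟩, ⟨p2, hp2⟩⟩, h2⟩ := hcompl.2 b
    simp only at h1 h2
    rw [← h1, ← h2]
    have c1 : Commute k1 k2 := hKc _ hk1 _ hk2
    have c2 : Commute p1 p2 := hPc _ hp1 _ hp2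
    have c3 : Commute p1 k2 := hKP _ hp1 _ hk2
    have c4 : Commute p2 k1 := hKP _ hp2 _ hk1
    exact (Commute.mul_left (c1.mul_right c4.symm) (c3.mul_right c2)).eq


variable {H : Type*} [Group H] [DecidableEq H] {D : Type*} [DivisionRing D]

/-- A faithful `H`-grading on `D`: a family of additive subgroups forming an internal
direct sum decomposition, multiplicative, with all components nonzero. -/
structure IsFaithfulGrading (𝒜 : H → AddSubgroup D) : Prop where
  one_mem : (1 : D) ∈ 𝒜 1
  mul_mem : ∀ {g h : H} {x y : D}, x ∈ 𝒜 g → y ∈ 𝒜 h → x * y ∈ 𝒜 (g * h)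
  isInternal : DirectSum.IsInternal 𝒜
  faithful : ∀ g, 𝒜 g ≠ ⊥

/-- Let `H` be a finite group of exponent `n_H` and `L` a field of
characteristic zero containing a primitive `n_H`-th root of unity.  If a twisted group
algebra `L^α H` over `L` is a division ring — encoded as a division ring `D` of
characteristic zero with a faithful `H`-grading whose identity component `L = D_e` is a
subfield contained in the center of `D`, all homogeneous components being
one-dimensional left `L`-vector spaces — then `H` is abelian. -/
theorem abelian_of_twisted_group_algebra_division_ring
    [Finite H] [CharZero D]
    (𝒜 : H → AddSubgroup D) (hG : IsFaithfulGrading 𝒜)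
    -- `D_e = L` is a subfield of `D` contained in the center of `D`
    (hcentral : ∀ l ∈ 𝒜 1, l ∈ Subring.center D)
    (hinvL : ∀ l ∈ 𝒜 1, l⁻¹ ∈ 𝒜 1)
    -- every homogeneous component is a one-dimensional left `L`-vector space
    (honedim : ∀ h : H, ∃ x : D, x ≠ 0 ∧ x ∈ 𝒜 h ∧ ∀ y ∈ 𝒜 h, ∃ l ∈ 𝒜 1, y = l * x)
    -- `L` contains a primitive `n_H`-th root of unity
    (ζ : D) (hζL : ζ ∈ 𝒜 1) (hζ : orderOf ζ = Monoid.exponent H) :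
    ∀ a b : H, a * b = b * a := by
  classical
  have hne : ∀ h : H, ∃ x : Dˣ, (x : D) ∈ 𝒜 h ∧ ∀ y ∈ 𝒜 h, ∃ l ∈ 𝒜 1, y = l * x := by
    intro h
    obtain ⟨x, hx0, hx, hy⟩ := honedim h
    exact ⟨Units.mk0 x hx0, hx, hy⟩
  choose u hu hspan using hne
  let L : Subgroup Dˣ :=
    { carrier := {x | (x : D) ∈ 𝒜 1}
      mul_mem' := by
        intro a b ha hb
        have := hG.mul_mem ha hb
        rw [mul_one] at this
        simpa using this
      one_mem' := by simpa using hG.one_mem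
      inv_mem' := by
        intro a ha
        have := hinvL _ ha
        simpa using this }
  have hmem : ∀ x : Dˣ, x ∈ L ↔ (x : D) ∈ 𝒜 1 := fun _ => Iff.rfl
  have hL : ∀ l ∈ L, ∀ d : Dˣ, Commute l d := by
    intro l hl d
    have := Subring.mem_center_iff.mp (hcentral _ hl) d
    ext
    simpa using this.symm
  have hLn : L.Normal := ⟨fun l hl g => by rw [← (hL l hl g).eq]; simpa using hl⟩
  have hspan' : ∀ (h : H) (y : Dˣ), (y : D) ∈ 𝒜 h → (y : Dˣ ⧸ L) = u h := by
    intro h y hy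
    obtain ⟨l, hl, e⟩ := hspan h y hy
    have hl0 : l ≠ 0 := by
      rintro rfl
      rw [zero_mul] at e
      exact y.ne_zero e
    have e' : y = Units.mk0 l hl0 * u h := by ext; simpa using e
    have hlL : Units.mk0 l hl0 ∈ L := hl
    rw [e', QuotientGroup.mk_mul, (QuotientGroup.eq_one_iff _).mpr hlL, one_mul]
  let f : H →* Dˣ ⧸ L := MonoidHom.mk' (fun h => (u h : Dˣ ⧸ L)) (by
    intro g h
    rw [← QuotientGroup.mk_mul]
    refine (hspan' (g * h) (u g * u h) ?_).symm
    rw [Units.val_mul]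
    exact hG.mul_mem (hu g) (hu h))
  have hf : Function.Injective f := by
    intro g h hgh
    have hgh' : (u g : Dˣ ⧸ L) = u h := hgh
    rw [QuotientGroup.eq, hmem] at hgh'
    have h1 := hG.mul_mem (hu g) hgh'
    rw [← Units.val_mul, mul_inv_cancel_left, mul_one] at h1
    by_contra hne
    have hd := (hG.isInternal.addSubgroup_iSupIndep).pairwiseDisjoint hne
    have := (AddSubgroup.disjoint_def.mp hd) h1 (hu h)
    exact (u h).ne_zero this
  have hn : 0 < Monoid.exponent H := Nat.pos_of_ne_zero Monoid.exponent_ne_zero_of_finite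
  have hz0 : ζ ≠ 0 := by
    rintro rfl
    have h1 := pow_orderOf_eq_one (0 : D)
    rw [hζ, zero_pow hn.ne'] at h1
    exact zero_ne_one h1
  have hzo : orderOf (Units.mk0 ζ hz0) = Monoid.exponent H := by
    rw [← hζ, ← orderOf_units]; rfl
  have hzL : Units.mk0 ζ hz0 ∈ L := hζL
  have hR : ∀ x : Dˣ, x ^ Monoid.exponent H = 1 → x ∈ L := by
    intro x hx
    obtain ⟨i, hi⟩ := tw_root _ hn ζ (hcentral _ hζL) hζ (x : D)
      (by rw [← Units.val_pow_eq_pow_val, hx, Units.val_one])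
    have : x = Units.mk0 ζ hz0 ^ i := by ext; simpa using hi
    rw [this]
    exact L.pow_mem hzL i
  exact tw_main two_ne_zero L hL _ hn hR _ hzL hzo _ f hf Monoid.order_dvd_exponent rfl
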